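/- Open summation formula for skew Schur functions: for 2h alphabets X^0,...,X^{h-1} and Y^0,...,Y^{h-1}, with X = X^0+...+X^{h-1} and Y = Y^0+...+Y^{h-1} their unions, and for any fixed partitions λ^0 and λ^h, one has Σ_{λ^1,...,λ^{h-1}} Σ_{μ^0,...,μ^{h-1}} ∏_{i=0}^{h-1} s_{λ^i/μ^i}(X^i) s_{λ^{i+1}/μ^i}(Y^i) = ∏_{0≤i<j≤h-1} Ψ(Y^i, X^j) · Σ_γ s_{λ^0/γ}(X) s_{λ^h/γ}(Y), as an identity of formal power series, where the unlisted sums range over all integer partitions. -/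

import Mathlib

open scoped BigOperators

/-- An integer partition: a weakly decreasing, finitely supported sequence of
nonnegative integers. -/
structure Ptn where
  toFun : ℕ →₀ ℕ
  antitone' : ∀ ⦃i j : ℕ⦄, i ≤ j → toFun j ≤ toFun i

namespace Ptn
/-- the `i`-th part (0-indexed) -/
def part (lam : Ptn) (i : ℕ) : ℕ := lam.toFun i
/-- the size `|λ|` -/
def size (lam : Ptn) : ℕ := lam.toFun.sum fun _ k => k
end Ptn

/-- `HStrip μ λ` means `μ ≺ λ`, i.e. `λ/μ` is a horizontal strip:
`λ_i ≥ μ_i ≥ λ_{i+1}` for all `i`. -/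
def HStrip (mu lam : Ptn) : Prop :=
  ∀ i : ℕ, mu.part i ≤ lam.part i ∧ lam.part (i + 1) ≤ mu.part i
/-- Chains of partitions `μ = c 0 ≺ c 1 ≺ ⋯` stabilizing at `λ`; these encode
semistandard Young tableaux of shape `λ/μ` with entries in `{0, 1, 2, …}`. -/
def IsSchurChain (mu lam : Ptn) (c : ℕ → Ptn) : Prop :=
  c 0 = mu ∧ (∀ i, HStrip (c i) (c (i + 1))) ∧ ∃ N, ∀ i, N ≤ i → c i = lam

/-- the monomial attached to a chain: the variable `X i` records the cells added
at step `i` of the chain -/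
noncomputable def chainWeight {R : Type*} [CommRing R] (X : ℕ → R) (c : ℕ → Ptn) : R :=
  ∏ᶠ i : ℕ, X i ^ ((c (i + 1)).size - (c i).size)

/-- the skew Schur function `s_{λ/μ}(X)` (which is `0` if `μ ⊄ λ`) -/
noncomputable def skewSchur {R : Type*} [CommRing R] [TopologicalSpace R]
    (X : ℕ → R) (lam mu : Ptn) : R :=
  ∑' c : {c : ℕ → Ptn // IsSchurChain mu lam c}, chainWeight X c.1

/-- `Ψ(X,Y) = ∏_{i,j} (1 - x_i y_j)⁻¹` -/
noncomputable def Psi {R : Type*} [CommRing R] [TopologicalSpace R] [Inv R] (X Y : ℕ → R) : R :=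
  ∏' p : ℕ × ℕ, (1 - X p.1 * Y p.2)⁻¹

/-- `Φ(X) = ∏_i (1 - x_i)⁻¹ ∏_{i<j} (1 - x_i x_j)⁻¹` -/
noncomputable def Phi {R : Type*} [CommRing R] [TopologicalSpace R] [Inv R] (X : ℕ → R) : R :=
  (∏' i : ℕ, (1 - X i)⁻¹) * ∏' p : {q : ℕ × ℕ // q.1 < q.2}, (1 - X p.1.1 * X p.1.2)⁻¹
/-- the coefficientwise (product) topology on multivariate formal power series -/
instance (σ : Type*) : TopologicalSpace (MvPowerSeries σ ℚ) :=
  inferInstanceAs (TopologicalSpace ((σ →₀ ℕ) → ℚ))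

/-- the ambient ring: formal power series in the independent variables
`x^{(i)}_n` and `y^{(i)}_n` (`i, n ∈ ℕ`) -/
abbrev R0 : Type := MvPowerSeries (Bool × ℕ × ℕ) ℚ

/-- the alphabet `X^i = {x^{(i)}_0, x^{(i)}_1, …}` -/
noncomputable def Xa (i n : ℕ) : R0 := MvPowerSeries.X (false, i, n)

/-- the alphabet `Y^i = {y^{(i)}_0, y^{(i)}_1, …}` -/
noncomputable def Ya (i n : ℕ) : R0 := MvPowerSeries.X (true, i, n)

/-- the union (disjoint sum) of the alphabets `A 0, …, A (h-1)` -/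
noncomputable def unionA (h : ℕ) (A : ℕ → ℕ → R0) : ℕ → R0 :=
  fun n => if h = 0 then 0 else A (n % h) (n / h)

open scoped ENNReal

namespace Ptn

theorem ext_part {mu lam : Ptn} (h : ∀ i, mu.part i = lam.part i) : mu = lam := by
  cases mu; cases lam
  congr 1
  exact Finsupp.ext h

theorem exists_part_eq_zero (lam : Ptn) : ∃ N, ∀ i, N ≤ i → lam.part i = 0 := by
  refine ⟨lam.toFun.support.sup id + 1, fun i hi => ?_⟩
  by_contra h
  have := Finset.le_sup (f := id) (Finsupp.mem_support_iff.2 h)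
  simp only [id] at this
  omega

theorem size_eq_sum_range (lam : Ptn) {N : ℕ} (hN : ∀ i, N ≤ i → lam.part i = 0) :
    lam.size = ∑ i ∈ Finset.range N, lam.part i := by
  refine Finset.sum_subset (fun i hi => ?_) (fun i _ hi => by simpa using hi)
  by_contra h
  exact Finsupp.mem_support_iff.1 hi (hN i (by simpa using h))

theorem part_le_part (lam : Ptn) {i j : ℕ} (h : i ≤ j) : lam.part j ≤ lam.part i :=
  lam.antitone' h

/-- The partition with a given eventually vanishing, weakly decreasing sequence of parts. -/
noncomputable def ofFun (f : ℕ → ℕ) (hf : ∀ i, f (i + 1) ≤ f i)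
    (h0 : ∃ N, ∀ i, N ≤ i → f i = 0) : Ptn where
  toFun := Finsupp.ofSupportFinite f <| by
    obtain ⟨N, hN⟩ := h0
    refine (Finset.range N).finite_toSet.subset fun i hi => ?_
    by_contra h
    exact hi (hN i (by simpa using h))
  antitone' := antitone_nat_of_succ_le hf

@[simp] theorem part_ofFun (f : ℕ → ℕ) (hf h0) (i : ℕ) : (ofFun f hf h0).part i = f i := rfl

theorem finite_setOf_part_le (lam : Ptn) : {mu : Ptn | ∀ i, mu.part i ≤ lam.part i}.Finite := by
  refine Set.Finite.of_finite_image (f := Ptn.toFun)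
    ((Set.finite_Iic lam.toFun).subset ?_) fun a _ b _ h => ext_part fun i => ?_
  · rintro _ ⟨mu, h, rfl⟩
    exact h
  · exact DFunLike.congr_fun h i

theorem size_le_size {mu lam : Ptn} (h : ∀ i, mu.part i ≤ lam.part i) : mu.size ≤ lam.size := by
  obtain ⟨N, hN⟩ := lam.exists_part_eq_zero
  rw [lam.size_eq_sum_range hN, mu.size_eq_sum_range fun i hi => by
    have := h i; have := hN i hi; omega]
  exact Finset.sum_le_sum fun i _ => h i

theorem eq_of_size_le {mu lam : Ptn} (h : ∀ i, mu.part i ≤ lam.part i)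
    (hs : lam.size ≤ mu.size) : mu = lam := by
  obtain ⟨N, hN⟩ := lam.exists_part_eq_zero
  have hN' : ∀ i, N ≤ i → mu.part i = 0 := fun i hi => by have := h i; have := hN i hi; omega
  rw [lam.size_eq_sum_range hN, mu.size_eq_sum_range hN'] at hs
  have key := (Finset.sum_eq_sum_iff_of_le (s := Finset.range N) fun i _ => h i).1
    (le_antisymm (Finset.sum_le_sum fun i _ => h i) hs)
  refine ext_part fun i => ?_
  rcases lt_or_ge i N with hi | hi
  · exact key i (by simpa using hi)
  · rw [hN i hi, hN' i hi]

end Ptn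

namespace HStrip

theorem size_le {mu lam : Ptn} (h : HStrip mu lam) : mu.size ≤ lam.size :=
  Ptn.size_le_size fun i => (h i).1

theorem refl (lam : Ptn) : HStrip lam lam := fun i => ⟨le_rfl, lam.part_le_part i.le_succ⟩

end HStrip

/-- The relation between the pair of partitions `μ, ν`, a common lower horizontal strip `κ`
together with `k`, and the common upper horizontal strip `λ` given by the local rule. -/
theorem size_add_size_of_localRule {mu nu lam kap : Ptn} {k : ℕ}
    (h0 : lam.part 0 = k + max (mu.part 0) (nu.part 0))
    (hs : ∀ i, lam.part (i + 1) + kap.part i =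
      max (mu.part (i + 1)) (nu.part (i + 1)) + min (mu.part i) (nu.part i)) :
    lam.size + kap.size = k + mu.size + nu.size := by
  obtain ⟨N₁, h₁⟩ := mu.exists_part_eq_zero
  obtain ⟨N₂, h₂⟩ := nu.exists_part_eq_zero
  obtain ⟨N₃, h₃⟩ := lam.exists_part_eq_zero
  obtain ⟨N₄, h₄⟩ := kap.exists_part_eq_zero
  obtain ⟨N, hN⟩ : ∃ N, N = N₁ + N₂ + N₃ + N₄ := ⟨_, rfl⟩
  have key : ∀ n, lam.part 0 + (∑ i ∈ Finset.range n, lam.part (i + 1)) +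
      ∑ i ∈ Finset.range n, kap.part i = k + (∑ i ∈ Finset.range n, mu.part i) +
        (∑ i ∈ Finset.range n, nu.part i) + max (mu.part n) (nu.part n) := by
    intro n
    induction n with
    | zero => simpa using h0
    | succ n ih =>
      simp only [Finset.sum_range_succ]
      have := hs n
      omega
  have := key N
  rw [lam.size_eq_sum_range (N := N + 1) (fun i hi => h₃ i (by omega)),
    kap.size_eq_sum_range (N := N) (fun i hi => h₄ i (by omega)),
    mu.size_eq_sum_range (N := N) (fun i hi => h₁ i (by omega)),
    nu.size_eq_sum_range (N := N) (fun i hi => h₂ i (by omega)), Finset.sum_range_succ']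
  have := h₁ N (by omega)
  have := h₂ N (by omega)
  omega

/-- The parts of the upper partition recovered by the local rule. -/
def localRuleFun (mu nu kap : Ptn) (k : ℕ) : ℕ → ℕ
  | 0 => k + max (mu.part 0) (nu.part 0)
  | i + 1 => max (mu.part (i + 1)) (nu.part (i + 1)) + min (mu.part i) (nu.part i) - kap.part i

/-- The local rule: common upper horizontal strips of `μ` and `ν` correspond to common lower
horizontal strips decorated by a natural number. -/
noncomputable def upperEquivLower (mu nu : Ptn) :
    {lam // HStrip mu lam ∧ HStrip nu lam} ≃ ℕ × {kap // HStrip kap mu ∧ HStrip kap nu} where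
  toFun lam := (lam.1.part 0 - max (mu.part 0) (nu.part 0),
    ⟨Ptn.ofFun (fun i => max (mu.part (i + 1)) (nu.part (i + 1)) + min (mu.part i) (nu.part i) -
        lam.1.part (i + 1))
      (fun i => by
        have := lam.2.1 (i + 1); have := lam.2.1 (i + 1 + 1); have := lam.2.1 i
        have := lam.2.2 (i + 1); have := lam.2.2 (i + 1 + 1); have := lam.2.2 i
        omega)
      (by
        obtain ⟨N₁, h₁⟩ := mu.exists_part_eq_zero
        obtain ⟨N₂, h₂⟩ := nu.exists_part_eq_zero
        refine ⟨N₁ + N₂, fun i hi => ?_⟩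
        have := h₁ i (by omega); have := h₁ (i + 1) (by omega)
        have := h₂ i (by omega); have := h₂ (i + 1) (by omega)
        omega),
      fun i => by
        have := lam.2.1 (i + 1); have := lam.2.1 i
        have := lam.2.2 (i + 1); have := lam.2.2 i
        simp only [Ptn.part_ofFun]
        omega,
      fun i => by
        have := lam.2.1 (i + 1); have := lam.2.1 i
        have := lam.2.2 (i + 1); have := lam.2.2 i
        simp only [Ptn.part_ofFun]
        omega⟩)
  invFun p := ⟨Ptn.ofFun (localRuleFun mu nu p.2.1 p.1)
      (fun i => by
        cases i with
        | zero =>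
          have := p.2.2.1 0; have := p.2.2.2 0
          simp only [localRuleFun]
          omega
        | succ i =>
          have := p.2.2.1 i; have := p.2.2.2 i
          have := p.2.2.1 (i + 1); have := p.2.2.2 (i + 1)
          simp only [localRuleFun]
          omega)
      (by
        obtain ⟨N₁, h₁⟩ := mu.exists_part_eq_zero
        obtain ⟨N₂, h₂⟩ := nu.exists_part_eq_zero
        refine ⟨N₁ + N₂ + 1, fun i hi => ?_⟩
        obtain ⟨i, rfl⟩ : ∃ j, i = j + 1 := ⟨i - 1, by omega⟩
        have := h₁ i (by omega); have := h₁ (i + 1) (by omega)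
        have := h₂ i (by omega); have := h₂ (i + 1) (by omega)
        simp only [localRuleFun]
        omega),
    fun i => by
      cases i with
      | zero =>
        have := p.2.2.1 0; have := p.2.2.2 0
        simp only [Ptn.part_ofFun, localRuleFun]
        omega
      | succ i =>
        have := p.2.2.1 i; have := p.2.2.2 i
        have := p.2.2.1 (i + 1); have := p.2.2.2 (i + 1)
        simp only [Ptn.part_ofFun, localRuleFun]
        omega,
    fun i => by
      cases i with
      | zero =>
        have := p.2.2.1 0; have := p.2.2.2 0
        simp only [Ptn.part_ofFun, localRuleFun]
        omega
      | succ i =>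
        have := p.2.2.1 i; have := p.2.2.2 i
        have := p.2.2.1 (i + 1); have := p.2.2.2 (i + 1)
        simp only [Ptn.part_ofFun, localRuleFun]
        omega⟩
  left_inv lam := by
    refine Subtype.ext (Ptn.ext_part fun i => ?_)
    cases i with
    | zero =>
      have := lam.2.1 0; have := lam.2.2 0
      simp only [Ptn.part_ofFun, localRuleFun]
      omega
    | succ i =>
      have := lam.2.1 (i + 1); have := lam.2.1 i
      have := lam.2.2 (i + 1); have := lam.2.2 i
      simp only [Ptn.part_ofFun, localRuleFun]
      omega
  right_inv p := by
    refine Prod.ext ?_ (Subtype.ext (Ptn.ext_part fun i => ?_))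
    · simp only [Ptn.part_ofFun, localRuleFun]
      omega
    · have := p.2.2.1 i; have := p.2.2.2 i
      simp only [Ptn.part_ofFun, localRuleFun]
      omega

theorem size_upperEquivLower {mu nu : Ptn} (lam : {lam // HStrip mu lam ∧ HStrip nu lam}) :
    lam.1.size + (upperEquivLower mu nu lam).2.1.size =
      (upperEquivLower mu nu lam).1 + mu.size + nu.size := by
  refine size_add_size_of_localRule ?_ fun i => ?_
  · have := lam.2.1 0; have := lam.2.2 0
    simp only [upperEquivLower, Equiv.coe_fn_mk]
    omega
  · have := lam.2.1 (i + 1); have := lam.2.1 i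
    have := lam.2.2 (i + 1); have := lam.2.2 i
    simp only [upperEquivLower, Equiv.coe_fn_mk, Ptn.part_ofFun]
    omega

/-- The sequence of parts of the image of `κ` under the Bender–Knuth involution on the
partitions with `μ ≺ κ ≺ λ`. -/
def benderKnuthFun (mu lam kap : Ptn) : ℕ → ℕ
  | 0 => max (mu.part 0) (lam.part (0 + 1)) + lam.part 0 - kap.part 0
  | i + 1 => max (mu.part (i + 1)) (lam.part (i + 1 + 1)) + min (lam.part (i + 1)) (mu.part i) -
      kap.part (i + 1)

theorem benderKnuthFun_add {mu lam kap : Ptn} (h : HStrip mu kap ∧ HStrip kap lam) :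
    benderKnuthFun mu lam kap 0 + kap.part 0 =
        lam.part 0 + max (mu.part 0) (lam.part (0 + 1)) ∧
      ∀ i, benderKnuthFun mu lam kap (i + 1) + kap.part (i + 1) =
        max (mu.part (i + 1)) (lam.part (i + 1 + 1)) + min (lam.part (i + 1)) (mu.part i) := by
  refine ⟨?_, fun i => ?_⟩
  · have := h.1 0; have := h.2 0
    simp only [benderKnuthFun]
    omega
  · have := h.1 i; have := h.2 i; have := h.1 (i + 1); have := h.2 (i + 1)
    simp only [benderKnuthFun]
    omega

/-- The Bender–Knuth involution on the partitions with `μ ≺ κ ≺ λ`. -/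
noncomputable def benderKnuth {mu lam : Ptn} (kap : {kap // HStrip mu kap ∧ HStrip kap lam}) :
    {kap // HStrip mu kap ∧ HStrip kap lam} :=
  ⟨Ptn.ofFun (benderKnuthFun mu lam kap)
      (fun i => by
        have := (benderKnuthFun_add kap.2).1
        have := (benderKnuthFun_add kap.2).2 i
        have := kap.2.1 i; have := kap.2.2 i; have := kap.2.1 (i + 1); have := kap.2.2 (i + 1)
        cases i with
        | zero =>
                    omega
        | succ i =>
          have := (benderKnuthFun_add kap.2).2 i
          have := kap.2.1 i; have := kap.2.2 i
          omega)
      (by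
        obtain ⟨N₁, h₁⟩ := mu.exists_part_eq_zero
        obtain ⟨N₂, h₂⟩ := lam.exists_part_eq_zero
        refine ⟨N₁ + N₂ + 1, fun i hi => ?_⟩
        obtain ⟨i, rfl⟩ : ∃ j, i = j + 1 := ⟨i - 1, by omega⟩
        have := (benderKnuthFun_add kap.2).2 i
        have := h₁ (i + 1) (by omega)
        have := h₂ (i + 1) (by omega); have := h₂ (i + 1 + 1) (by omega)
        omega),
    fun i => by
      have := (benderKnuthFun_add kap.2).2 i
      have := kap.2.1 i; have := kap.2.2 i; have := kap.2.1 (i + 1); have := kap.2.2 (i + 1)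
      simp only [Ptn.part_ofFun]
      cases i with
      | zero =>
        have := (benderKnuthFun_add kap.2).1
        omega
      | succ i =>
        have := (benderKnuthFun_add kap.2).2 i
        have := kap.2.1 i; have := kap.2.2 i
        omega,
    fun i => by
      have := kap.2.1 i; have := kap.2.2 i
      simp only [Ptn.part_ofFun]
      cases i with
      | zero =>
        have := (benderKnuthFun_add kap.2).1
        omega
      | succ i =>
        have := (benderKnuthFun_add kap.2).2 i
        have := kap.2.1 i; have := kap.2.2 i
        omega⟩

theorem benderKnuth_involutive (mu lam : Ptn) :
    Function.Involutive (benderKnuth (mu := mu) (lam := lam)) := by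
  intro kap
  refine Subtype.ext (Ptn.ext_part fun i => ?_)
  have h := benderKnuthFun_add kap.2
  have h' := benderKnuthFun_add (benderKnuth kap).2
  have e : ∀ k : {kap // HStrip mu kap ∧ HStrip kap lam}, ∀ i,
    (benderKnuth k).1.part i = benderKnuthFun mu lam k.1 i := fun _ _ => rfl
  rw [e]
  cases i with
  | zero =>
    have h1 := h.1; have h2 := h'.1
    rw [e] at h2
    omega
  | succ i =>
    have h1 := h.2 i; have h2 := h'.2 i
    rw [e] at h2
    omega

theorem size_benderKnuth {mu lam : Ptn} (kap : {kap // HStrip mu kap ∧ HStrip kap lam}) :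
    (benderKnuth kap).1.size + kap.1.size = mu.size + lam.size := by
  obtain ⟨N₁, h₁⟩ := lam.exists_part_eq_zero
  have hz : ∀ k : {kap // HStrip mu kap ∧ HStrip kap lam}, ∀ i, N₁ ≤ i → k.1.part i = 0 :=
    fun k i hi => by have := (k.2.2 i).1; have := h₁ i hi; omega
  have key : ∀ n, (∑ i ∈ Finset.range (n + 1), (benderKnuth kap).1.part i) +
      ∑ i ∈ Finset.range (n + 1), kap.1.part i = (∑ i ∈ Finset.range n, mu.part i) +
        (∑ i ∈ Finset.range (n + 1), lam.part i) + max (mu.part n) (lam.part (n + 1)) := by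
    intro n
    induction n with
    | zero =>
      have := (benderKnuthFun_add kap.2).1
      simp only [Finset.sum_range_succ, Finset.sum_range_zero]
      rw [show (benderKnuth kap).1.part 0 = benderKnuthFun mu lam kap.1 0 from rfl]
      omega
    | succ n ih =>
      rw [Finset.sum_range_succ _ (n + 1), Finset.sum_range_succ _ (n + 1),
        Finset.sum_range_succ mu.part n, Finset.sum_range_succ _ (n + 1)]
      have : (benderKnuth kap).1.part (n + 1) + _ = _ := (benderKnuthFun_add kap.2).2 n
      omega
  have h2 := key N₁
  have hmu : ∀ i, N₁ ≤ i → mu.part i = 0 := fun i hi => by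
    have := (kap.2.1 i).1; have := hz kap i hi; omega
  rw [Ptn.size_eq_sum_range _ fun i (hi : N₁ + 1 ≤ i) => hz _ i (by omega),
    Ptn.size_eq_sum_range kap.1 fun i (hi : N₁ + 1 ≤ i) => hz _ i (by omega),
    mu.size_eq_sum_range hmu, lam.size_eq_sum_range fun i (hi : N₁ + 1 ≤ i) => h₁ i (by omega)]
  have := hmu N₁ le_rfl
  have := h₁ (N₁ + 1) (by omega)
  omega

/-- Power series with extended nonnegative coefficients, in which every family is summable. -/
abbrev ESer (σ : Type*) := MvPowerSeries σ ℝ≥0∞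

section psum

variable {σ ι κ : Type*}

/-- The coefficientwise sum of an arbitrary family. -/
noncomputable def psum (f : ι → ESer σ) : ESer σ := fun m => ∑' i, MvPowerSeries.coeff m (f i)

theorem coeff_psum (f : ι → ESer σ) (m : σ →₀ ℕ) :
    MvPowerSeries.coeff m (psum f) = ∑' i, MvPowerSeries.coeff m (f i) := rfl

theorem mul_psum (a : ESer σ) (f : ι → ESer σ) : a * psum f = psum fun i => a * f i := by
  classical
  ext m
  simp only [coeff_psum, MvPowerSeries.coeff_mul, ← ENNReal.tsum_mul_left]
  exact (Summable.tsum_finsetSum fun _ _ => ENNReal.summable).symm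

theorem psum_mul (a : ESer σ) (f : ι → ESer σ) : psum f * a = psum fun i => f i * a := by
  simp only [mul_comm _ a, mul_psum]

theorem psum_comm (f : ι → κ → ESer σ) :
    (psum fun i => psum fun j => f i j) = psum fun j => psum fun i => f i j := by
  ext m
  exact ENNReal.tsum_comm

theorem psum_prod (f : ι × κ → ESer σ) : psum f = psum fun i => psum fun j => f (i, j) := by
  ext m
  exact ENNReal.tsum_prod (f := fun i j => MvPowerSeries.coeff m (f (i, j)))

theorem psum_sigma {κ : ι → Type*} (f : (Σ i, κ i) → ESer σ) :
    psum f = psum fun i => psum fun j => f ⟨i, j⟩ := by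
  ext m
  exact ENNReal.tsum_sigma' _

theorem psum_equiv (e : ι ≃ κ) (f : κ → ESer σ) : (psum fun i => f (e i)) = psum f := by
  ext m
  exact e.tsum_eq fun i => MvPowerSeries.coeff m (f i)

theorem psum_eq_single {f : ι → ESer σ} (i : ι) (h : ∀ j, j ≠ i → f j = 0) :
    psum f = f i := by
  ext m
  exact tsum_eq_single i fun j hj => by rw [h j hj, map_zero]

theorem psum_zero : (psum fun _ : ι => (0 : ESer σ)) = 0 := by
  ext m
  simp [coeff_psum]

theorem psum_subtype (P : ι → Prop) [DecidablePred P] (f : ι → ESer σ) :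
    (psum fun i : {i // P i} => f i) = psum fun i => if P i then f i else 0 := by
  ext m
  simp only [coeff_psum]
  rw [show (∑' i : {i // P i}, _) = _ from
    tsum_subtype {i | P i} fun i => MvPowerSeries.coeff m (f i)]
  refine tsum_congr fun i => ?_
  by_cases h : P i <;> simp [h]

theorem psum_pi_prod {n : ℕ} (f : Fin n → κ → ESer σ) :
    (psum fun g : Fin n → κ => ∏ i, f i (g i)) = ∏ i, psum (f i) := by
  induction n with
  | zero =>
    rw [psum_eq_single default fun j hj => (hj (Subsingleton.elim _ _)).elim]
    simp
  | succ n ih =>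
    let e : κ × (Fin n → κ) ≃ (Fin (n + 1) → κ) := Fin.consEquiv fun _ => κ
    rw [Fin.prod_univ_succ, ← ih fun i => f i.succ, psum_mul, ← psum_equiv e, psum_prod]
    refine congrArg psum (funext fun a => ?_)
    rw [mul_psum]
    refine congrArg psum (funext fun g => ?_)
    exact Fin.prod_univ_succ _

/-- The geometric series `∑ zᵏ`. -/
noncomputable def geom (z : ESer σ) : ESer σ := psum fun k : ℕ => z ^ k

theorem geom_eq (z : ESer σ) : geom z = 1 + z * geom z := by
  rw [geom, mul_psum]
  ext m
  rw [coeff_psum, map_add, coeff_psum, tsum_eq_zero_add' ENNReal.summable, pow_zero]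
  simp only [pow_succ']

end psum

section trunc

variable {σ R ι : Type*} [CommSemiring R]

open scoped Classical in
/-- The underlying function of `trunc`. -/
noncomputable def truncFun (T : Set σ) (f : MvPowerSeries σ R) : MvPowerSeries σ R :=
  fun m => if (m.support : Set σ) ⊆ T then MvPowerSeries.coeff m f else 0

theorem coeff_truncFun {T : Set σ} {m : σ →₀ ℕ} (h : (m.support : Set σ) ⊆ T)
    (f : MvPowerSeries σ R) :
    MvPowerSeries.coeff m (truncFun T f) = MvPowerSeries.coeff m f := if_pos h

theorem coeff_truncFun_of_not {T : Set σ} {m : σ →₀ ℕ} (h : ¬ (m.support : Set σ) ⊆ T)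
    (f : MvPowerSeries σ R) : MvPowerSeries.coeff m (truncFun T f) = 0 := if_neg h

/-- Setting to zero all variables outside `T`. -/
noncomputable def trunc (R : Type*) [CommSemiring R] (T : Set σ) :
    MvPowerSeries σ R →+* MvPowerSeries σ R where
  toFun := truncFun T
  map_zero' := by
    ext m
    by_cases h : (m.support : Set σ) ⊆ T
    · rw [coeff_truncFun h]
    · rw [coeff_truncFun_of_not h, map_zero]
  map_add' f g := by
    ext m
    by_cases h : (m.support : Set σ) ⊆ T
    · simp only [map_add, coeff_truncFun h]
    · simp only [map_add, coeff_truncFun_of_not h, add_zero]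
  map_one' := by
    classical
    ext m
    by_cases h : (m.support : Set σ) ⊆ T
    · rw [coeff_truncFun h]
    · rw [coeff_truncFun_of_not h, MvPowerSeries.coeff_one, if_neg]
      rintro rfl
      simp at h
  map_mul' f g := by
    classical
    ext m
    by_cases h : (m.support : Set σ) ⊆ T
    · rw [coeff_truncFun h, MvPowerSeries.coeff_mul, MvPowerSeries.coeff_mul]
      refine Finset.sum_congr rfl fun p hp => ?_
      rw [Finset.HasAntidiagonal.mem_antidiagonal] at hp
      rw [coeff_truncFun, coeff_truncFun]
      · refine subset_trans (Finset.coe_subset.2 ?_) h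
        rw [← hp]
        exact Finsupp.support_mono le_add_self
      · refine subset_trans (Finset.coe_subset.2 ?_) h
        rw [← hp]
        exact Finsupp.support_mono le_self_add
    · rw [coeff_truncFun_of_not h, MvPowerSeries.coeff_mul]
      refine (Finset.sum_eq_zero fun p hp => ?_).symm
      rw [Finset.HasAntidiagonal.mem_antidiagonal] at hp
      by_cases h1 : (p.1.support : Set σ) ⊆ T
      · by_cases h2 : (p.2.support : Set σ) ⊆ T
        · refine (h ?_).elim
          rw [← hp]
          refine subset_trans (Finset.coe_subset.2 Finsupp.support_add) ?_
          simp [h1, h2]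
        · rw [coeff_truncFun_of_not h2, mul_zero]
      · rw [coeff_truncFun_of_not h1, zero_mul]

theorem coeff_trunc {T : Set σ} {m : σ →₀ ℕ} (h : (m.support : Set σ) ⊆ T)
    (f : MvPowerSeries σ R) :
    MvPowerSeries.coeff m (trunc R T f) = MvPowerSeries.coeff m f := coeff_truncFun h f

theorem coeff_trunc_of_not {T : Set σ} {m : σ →₀ ℕ} (h : ¬ (m.support : Set σ) ⊆ T)
    (f : MvPowerSeries σ R) : MvPowerSeries.coeff m (trunc R T f) = 0 :=
  coeff_truncFun_of_not h f

theorem trunc_map {S : Type*} [CommSemiring S] (φ : R →+* S) (T : Set σ)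
    (f : MvPowerSeries σ R) :
    trunc S T (MvPowerSeries.map φ f) = MvPowerSeries.map φ (trunc R T f) := by
  ext m
  by_cases h : (m.support : Set σ) ⊆ T
  · simp [coeff_trunc h]
  · simp [coeff_trunc_of_not h]

theorem trunc_X_of_mem {T : Set σ} {s : σ} (h : s ∈ T) :
    trunc R T (MvPowerSeries.X s) = MvPowerSeries.X s := by
  classical
  ext m
  by_cases hm : (m.support : Set σ) ⊆ T
  · rw [coeff_trunc hm]
  · rw [coeff_trunc_of_not hm, MvPowerSeries.coeff_X, if_neg]
    rintro rfl
    refine hm fun t ht => ?_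
    rw [Finset.mem_coe, Finsupp.mem_support_iff, Finsupp.single_apply] at ht
    rwa [← show s = t by by_contra h; simp [h] at ht]

theorem trunc_X_of_notMem {T : Set σ} {s : σ} (h : s ∉ T) :
    trunc R T (MvPowerSeries.X s) = 0 := by
  classical
  ext m
  by_cases hm : (m.support : Set σ) ⊆ T
  · rw [coeff_trunc hm, MvPowerSeries.coeff_X, if_neg, map_zero]
    rintro rfl
    exact h (hm (by simp))
  · rw [coeff_trunc_of_not hm, map_zero]

theorem trunc_psum (T : Set σ) (f : ι → ESer σ) :
    trunc ℝ≥0∞ T (psum f) = psum fun i => trunc ℝ≥0∞ T (f i) := by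
  ext m
  by_cases h : (m.support : Set σ) ⊆ T
  · simp [coeff_psum, coeff_trunc h]
  · simp [coeff_psum, coeff_trunc_of_not h]

theorem trunc_geom (T : Set σ) (z : ESer σ) :
    trunc ℝ≥0∞ T (geom z) = geom (trunc ℝ≥0∞ T z) := by
  simp only [geom, trunc_psum, map_pow]

end trunc

/-- Matrices of power series indexed by partitions. -/
def PMat (σ : Type*) := Ptn → Ptn → ESer σ

namespace PMat

variable {σ : Type*}

theorem ext' {A B : PMat σ} (h : ∀ mu lam, A mu lam = B mu lam) : A = B :=
  funext fun mu => funext fun lam => h mu lam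

open scoped Classical in
noncomputable instance : Monoid (PMat σ) where
  mul A B mu lam := psum fun kap => A mu kap * B kap lam
  one mu lam := if mu = lam then 1 else 0
  mul_assoc A B C := by
    refine ext' fun mu lam => ?_
    change (psum fun kap => (psum fun nu => A mu nu * B nu kap) * C kap lam) =
      psum fun nu => A mu nu * psum fun kap => B nu kap * C kap lam
    simp only [psum_mul, mul_psum, mul_assoc]
    exact psum_comm _
  one_mul A := by
    refine ext' fun mu lam => ?_
    change (psum fun kap => (if mu = kap then 1 else 0) * A kap lam) = A mu lam
    rw [psum_eq_single mu fun kap h => by simp [h.symm]]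
    simp
  mul_one A := by
    refine ext' fun mu lam => ?_
    change (psum fun kap => A mu kap * (if kap = lam then 1 else 0)) = A mu lam
    rw [psum_eq_single lam fun kap h => by simp [h]]
    simp

theorem mul_apply (A B : PMat σ) (mu lam : Ptn) :
    (A * B) mu lam = psum fun kap => A mu kap * B kap lam := rfl

open scoped Classical in
theorem one_apply (mu lam : Ptn) : (1 : PMat σ) mu lam = if mu = lam then 1 else 0 := rfl

noncomputable instance : MulAction (ESer σ) (PMat σ) where
  smul a A mu lam := a * A mu lam
  one_smul A := ext' fun mu lam => one_mul (A mu lam)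
  mul_smul a b A := ext' fun mu lam => mul_assoc a b (A mu lam)

theorem smul_apply (a : ESer σ) (A : PMat σ) (mu lam : Ptn) : (a • A) mu lam = a * A mu lam := rfl

instance : IsScalarTower (ESer σ) (PMat σ) (PMat σ) where
  smul_assoc a A B := ext' fun mu lam => by
    simp only [smul_apply, mul_apply, smul_eq_mul, mul_psum, mul_assoc]

instance : SMulCommClass (ESer σ) (PMat σ) (PMat σ) where
  smul_comm a A B := ext' fun mu lam => by
    simp only [smul_apply, mul_apply, smul_eq_mul, mul_psum, mul_left_comm]

/-- The transpose. -/
def transpose (A : PMat σ) : PMat σ := fun mu lam => A lam mu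

theorem transpose_mul (A B : PMat σ) : (A * B).transpose = B.transpose * A.transpose :=
  ext' fun _ _ => congrArg psum (funext fun _ => mul_comm _ _)

theorem transpose_one : (1 : PMat σ).transpose = 1 :=
  ext' fun mu lam => by
    simp only [transpose, one_apply]
    congr 1
    exact propext eq_comm

/-- Setting to zero all variables outside `T` in each entry. -/
noncomputable def truncHom (T : Set σ) : PMat σ →* PMat σ where
  toFun A mu lam := trunc ℝ≥0∞ T (A mu lam)
  map_one' := ext' fun mu lam => by
    simp only [one_apply]
    split_ifs <;> simp
  map_mul' A B := ext' fun mu lam => by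
    rw [mul_apply, trunc_psum]
    exact congrArg psum (funext fun kap => map_mul _ _ _)

theorem truncHom_apply (T : Set σ) (A : PMat σ) (mu lam : Ptn) :
    truncHom T A mu lam = trunc ℝ≥0∞ T (A mu lam) := rfl

/-- An entry of a product of matrices is a sum over paths. -/
theorem prod_range_apply (A : ℕ → PMat σ) (h : ℕ) (a b : Ptn) :
    ((List.range h).map A).prod a b =
      psum fun L : {L : Fin (h + 1) → Ptn // L 0 = a ∧ L (Fin.last h) = b} =>
        ∏ i : Fin h, A i (L.1 i.castSucc) (L.1 i.succ) := by
  induction h generalizing b with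
  | zero =>
    simp only [List.range_zero, List.map_nil, List.prod_nil, one_apply, Finset.univ_eq_empty,
      Finset.prod_empty]
    split_ifs with h
    · rw [psum_eq_single ⟨fun _ => a, rfl, h⟩ fun j hj =>
        (hj (Subtype.ext (funext fun i => ?_))).elim]
      rw [Fin.fin_one_eq_zero i, j.2.1]
    · have : IsEmpty {L : Fin (0 + 1) → Ptn // L 0 = a ∧ L (Fin.last 0) = b} :=
        ⟨fun L => h (L.2.1.symm.trans L.2.2)⟩
      ext m
      rw [coeff_psum, tsum_empty, map_zero]
  | succ h ih =>
    rw [List.prod_range_succ, mul_apply]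
    let e : {L : Fin (h + 1 + 1) → Ptn // L 0 = a ∧ L (Fin.last (h + 1)) = b} ≃
        Σ kap : Ptn, {L : Fin (h + 1) → Ptn // L 0 = a ∧ L (Fin.last h) = kap} :=
      { toFun := fun L => ⟨L.1 (Fin.last h).castSucc, fun i => L.1 i.castSucc, L.2.1, rfl⟩
        invFun := fun p => ⟨Fin.snoc (α := fun _ => Ptn) p.2.1 b, by
            exact (Fin.snoc_castSucc (α := fun _ => Ptn) b p.2.1 0).trans p.2.2.1,
            Fin.snoc_last _ _⟩
        left_inv := fun L => Subtype.ext <| funext fun i => by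
          refine Fin.lastCases ?_ (fun i => ?_) i
          · simpa using L.2.2.symm
          · simp
        right_inv := by
          rintro ⟨kap, L, h1, rfl⟩
          exact Sigma.subtype_ext (by simp) (funext fun i => by simp) }
    rw [← psum_equiv e.symm, psum_sigma]
    refine congrArg psum (funext fun kap => ?_)
    rw [ih, psum_mul]
    refine congrArg psum (funext fun L => ?_)
    rw [Fin.prod_univ_castSucc]
    congr 1
    · refine Finset.prod_congr rfl fun i _ => ?_
      simp only [e, Equiv.coe_fn_symm_mk, ← Fin.castSucc_succ, Fin.snoc_castSucc, Fin.val_castSucc]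
    · simp only [e, Equiv.coe_fn_symm_mk, Fin.succ_last, Fin.snoc_castSucc, Fin.snoc_last,
        L.2.2, Fin.val_last]

end PMat

section operators

open PMat

variable {σ : Type*}

open scoped Classical in
/-- The operator adding a horizontal strip, weighted by `x` to its size. -/
noncomputable def addStrip (x : ESer σ) : PMat σ := fun mu lam =>
  if HStrip mu lam then x ^ (lam.size - mu.size) else 0

theorem addStrip_mul_transpose (x y : ESer σ) :
    addStrip y * (addStrip x).transpose = geom (y * x) • ((addStrip x).transpose * addStrip y) := by
  classical
  refine ext' fun mu nu => ?_
  simp only [smul_apply, mul_apply, transpose, addStrip, ite_zero_mul_ite_zero]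
  rw [← psum_subtype (fun lam => HStrip mu lam ∧ HStrip nu lam) fun lam =>
      y ^ (lam.size - mu.size) * x ^ (lam.size - nu.size),
    ← psum_subtype (fun kap => HStrip kap mu ∧ HStrip kap nu) fun kap =>
      x ^ (mu.size - kap.size) * y ^ (nu.size - kap.size),
    geom, psum_mul, ← psum_equiv (upperEquivLower mu nu).symm, psum_prod]
  refine congrArg psum (funext fun k => ?_)
  rw [mul_psum]
  refine congrArg psum (funext fun kap => ?_)
  obtain ⟨lam, h⟩ := (upperEquivLower mu nu).surjective (k, kap)
  have hs := size_upperEquivLower lam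
  have h1 := lam.2.1.size_le
  have h2 := lam.2.2.size_le
  have h3 := kap.2.1.size_le
  have h4 := kap.2.2.size_le
  rw [← h, Equiv.symm_apply_apply]
  rw [h] at hs
  dsimp only at hs
  rw [show lam.1.size - mu.size = k + (nu.size - kap.1.size) by omega,
    show lam.1.size - nu.size = k + (mu.size - kap.1.size) by omega]
  ring

theorem commute_addStrip (x y : ESer σ) : Commute (addStrip x) (addStrip y) := by
  classical
  refine ext' fun mu lam => ?_
  simp only [mul_apply, addStrip, ite_zero_mul_ite_zero]
  rw [← psum_subtype (fun kap => HStrip mu kap ∧ HStrip kap lam) fun kap =>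
      x ^ (kap.size - mu.size) * y ^ (lam.size - kap.size),
    ← psum_subtype (fun kap => HStrip mu kap ∧ HStrip kap lam) fun kap =>
      y ^ (kap.size - mu.size) * x ^ (lam.size - kap.size),
    ← psum_equiv (benderKnuth_involutive mu lam).toPerm]
  refine congrArg psum (funext fun kap => ?_)
  have hs := size_benderKnuth kap
  have h1 := kap.2.1.size_le
  have h2 := kap.2.2.size_le
  rw [Function.Involutive.coe_toPerm,
    show (benderKnuth kap).1.size - mu.size = lam.size - kap.1.size by omega,
    show lam.size - (benderKnuth kap).1.size = kap.1.size - mu.size by omega, mul_comm]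

/-- The monomial attached to a chain, over a semiring. -/
noncomputable def eChainWeight {R : Type*} [CommSemiring R] (X : ℕ → R) (c : ℕ → Ptn) : R :=
  ∏ᶠ i : ℕ, X i ^ ((c (i + 1)).size - (c i).size)

theorem IsSchurChain.exists_mulSupport_subset {mu lam : Ptn} {c : ℕ → Ptn}
    (hc : IsSchurChain mu lam c) : ∃ N, ∀ (R : Type*) [CommSemiring R] (X : ℕ → R),
      Function.mulSupport (fun i => X i ^ ((c (i + 1)).size - (c i).size)) ⊆
        (Finset.range N : Finset ℕ) := by
  obtain ⟨N, hN⟩ := hc.2.2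
  refine ⟨N, fun R _ X i hi => ?_⟩
  by_contra h
  have h' : N ≤ i := by simpa using h
  exact hi (by simp [hN i h', hN (i + 1) (by omega)])

theorem IsSchurChain.exists_eChainWeight_eq {mu lam : Ptn} {c : ℕ → Ptn}
    (hc : IsSchurChain mu lam c) : ∃ N, ∀ (R : Type*) [CommSemiring R] (X : ℕ → R),
      eChainWeight X c = ∏ i ∈ Finset.range N, X i ^ ((c (i + 1)).size - (c i).size) := by
  obtain ⟨N, hN⟩ := hc.exists_mulSupport_subset
  exact ⟨N, fun R _ X => finprod_eq_prod_of_mulSupport_subset _ (hN R X)⟩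

theorem IsSchurChain.eChainWeight_succ {R : Type*} [CommSemiring R] {mu lam : Ptn}
    {c : ℕ → Ptn} (hc : IsSchurChain mu lam c) (X : ℕ → R) :
    eChainWeight X c = X 0 ^ ((c 1).size - (c 0).size) *
      eChainWeight (fun n => X (n + 1)) fun n => c (n + 1) := by
  obtain ⟨N, hN⟩ := hc.exists_mulSupport_subset
  have h := hN R X
  rw [eChainWeight, eChainWeight, finprod_eq_prod_of_mulSupport_subset (s := Finset.range (N + 1)) _
    (h.trans (Finset.coe_subset.2 (Finset.range_mono N.le_succ))),
    finprod_eq_prod_of_mulSupport_subset (s := Finset.range N), Finset.prod_range_succ', mul_comm]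
  intro i hi
  have := h (a := i + 1) hi
  simp only [Finset.coe_range, Set.mem_Iio] at this ⊢
  omega

/-- Splitting off the first step of a chain. -/
def schurChainEquiv (mu lam : Ptn) : {c // IsSchurChain mu lam c} ≃
    Σ kap : {kap // HStrip mu kap}, {c // IsSchurChain kap lam c} where
  toFun c := ⟨⟨c.1 1, by have := c.2.2.1 0; rwa [c.2.1] at this⟩, fun n => c.1 (n + 1), rfl,
    fun i => c.2.2.1 (i + 1), by
      obtain ⟨N, hN⟩ := c.2.2.2
      exact ⟨N, fun i hi => hN (i + 1) (by omega)⟩⟩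
  invFun p := ⟨fun n => Nat.casesOn n mu p.2.1, rfl, fun i => by
      cases i with
      | zero =>
        change HStrip mu (p.2.1 0)
        rw [p.2.2.1]
        exact p.1.2
      | succ i => exact p.2.2.2.1 i, by
      obtain ⟨N, hN⟩ := p.2.2.2.2
      refine ⟨N + 1, fun i hi => ?_⟩
      obtain ⟨i, rfl⟩ : ∃ j, i = j + 1 := ⟨i - 1, by omega⟩
      exact hN i (by omega)⟩
  left_inv c := Subtype.ext <| funext fun n => by
    cases n with
    | zero => exact c.2.1.symm
    | succ n => rfl
  right_inv := by
    rintro ⟨⟨kap, h⟩, c, hc⟩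
    exact Sigma.subtype_ext (Subtype.ext hc.1) rfl

/-- The matrix of skew Schur functions `s_{λ/μ}(X)`, with `μ` indexing the rows. -/
noncomputable def schurMat (X : ℕ → ESer σ) : PMat σ := fun mu lam =>
  psum fun c : {c // IsSchurChain mu lam c} => eChainWeight X c.1

theorem schurMat_eq_mul (X : ℕ → ESer σ) :
    schurMat X = addStrip (X 0) * schurMat fun n => X (n + 1) := by
  classical
  refine ext' fun mu lam => ?_
  simp only [mul_apply, addStrip, ite_mul, zero_mul]
  rw [← psum_subtype (HStrip mu), schurMat, ← psum_equiv (schurChainEquiv mu lam).symm, psum_sigma]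
  refine congrArg psum (funext fun kap => ?_)
  rw [schurMat, mul_psum]
  refine congrArg psum (funext fun c => ?_)
  rw [((schurChainEquiv mu lam).symm ⟨kap, c⟩).2.eChainWeight_succ]
  change X 0 ^ ((c.1 0).size - mu.size) * _ = _
  rw [c.2.1]
  rfl

theorem schurMat_zero : schurMat (fun _ => (0 : ESer σ)) = 1 := by
  classical
  refine ext' fun mu lam => ?_
  have key : ∀ c : {c // IsSchurChain mu lam c}, (∃ i, c.1 i ≠ mu) →
      eChainWeight (fun _ => (0 : ESer σ)) c.1 = 0 := by
    rintro ⟨c, hc⟩ ⟨i, hi⟩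
    obtain ⟨N, hN⟩ := hc.exists_mulSupport_subset
    obtain ⟨j, hj⟩ : ∃ j, c (j + 1) ≠ c j := by
      by_contra! h
      refine hi ?_
      induction i with
      | zero => exact hc.1
      | succ i ih => exact (h i).trans (by_contra fun h' => h' (ih fun h'' => h' h''))
    have hlt : (c (j + 1)).size - (c j).size ≠ 0 := fun h => hj <|
      (Ptn.eq_of_size_le (fun k => (hc.2.1 j k).1) (by omega)).symm
    rw [eChainWeight, finprod_eq_prod_of_mulSupport_subset _ (hN _ _)]
    refine Finset.prod_eq_zero (i := j) ?_ (zero_pow hlt)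
    refine Finset.mem_coe.1 (hN (ESer σ) (fun _ => 0) ?_)
    simp [zero_pow hlt]
  rw [one_apply, schurMat]
  split_ifs with h
  · subst h
    rw [psum_eq_single ⟨fun _ => mu, rfl, fun _ => HStrip.refl mu, 0, fun _ _ => rfl⟩]
    · simp [eChainWeight]
    · intro c hc
      refine key c ?_
      by_contra! h
      exact hc (Subtype.ext (funext h))
  · refine (congrArg psum (funext fun c => key c ?_)).trans psum_zero
    obtain ⟨N, hN⟩ := c.2.2.2
    exact ⟨N, fun h' => h (h'.symm.trans (hN N le_rfl))⟩

theorem schurMat_eq_prod_mul (X : ℕ → ESer σ) (N : ℕ) :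
    schurMat X = ((List.range N).map fun n => addStrip (X n)).prod *
      schurMat fun n => X (N + n) := by
  induction N with
  | zero => simp
  | succ N ih =>
    rw [ih, List.prod_range_succ, schurMat_eq_mul fun n => X (N + n), mul_assoc]
    simp only [Nat.add_zero, Nat.add_assoc, Nat.add_comm 1]

theorem schurMat_eq_prod {X : ℕ → ESer σ} {N : ℕ} (h : ∀ n, N ≤ n → X n = 0) :
    schurMat X = ((List.range N).map fun n => addStrip (X n)).prod := by
  rw [schurMat_eq_prod_mul X N, funext fun n => h (N + n) (by omega), schurMat_zero, mul_one]

theorem truncHom_schurMat (T : Set σ) (X : ℕ → ESer σ) :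
    truncHom T (schurMat X) = schurMat fun n => trunc ℝ≥0∞ T (X n) := by
  refine ext' fun mu lam => ?_
  rw [truncHom_apply, schurMat, trunc_psum]
  refine congrArg psum (funext fun c => ?_)
  obtain ⟨N, hN⟩ := c.2.exists_eChainWeight_eq
  rw [hN, hN, map_prod]
  simp only [map_pow]

end operators

section products

variable {M : Type*} [Monoid M]

theorem commute_prod_range {a : M} {f : ℕ → M} {n : ℕ} (h : ∀ i < n, Commute a (f i)) :
    Commute a ((List.range n).map f).prod := by
  induction n with
  | zero => simp
  | succ n ih =>
    rw [List.prod_range_succ]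
    exact (ih fun i hi => h i (by omega)).mul_right (h n (by omega))

theorem prod_range_map_mul {f g : ℕ → M} (h : ∀ i j, Commute (f i) (g j)) (n : ℕ) :
    ((List.range n).map fun i => f i * g i).prod =
      ((List.range n).map f).prod * ((List.range n).map g).prod := by
  induction n with
  | zero => simp
  | succ n ih =>
    simp only [List.prod_range_succ, ih]
    have := (commute_prod_range (a := f n) (f := g) (n := n) fun i _ => h n i).eq
    simp only [mul_assoc]
    rw [← mul_assoc (f n), this, mul_assoc]

theorem prod_range_add (f : ℕ → M) (m n : ℕ) :
    ((List.range (m + n)).map f).prod =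
      ((List.range m).map f).prod * ((List.range n).map fun i => f (m + i)).prod := by
  induction n with
  | zero => simp
  | succ n ih => rw [← Nat.add_assoc, List.prod_range_succ, ih, List.prod_range_succ, mul_assoc]

/-- A doubly indexed product of commuting factors, in two different orders. -/
theorem prod_range_prod_range {f : ℕ → ℕ → M} (hf : ∀ i j k l, Commute (f i j) (f k l))
    (h N : ℕ) : ((List.range h).map fun i => ((List.range N).map (f i)).prod).prod =
      ((List.range (h * N)).map fun k => f (k % h) (k / h)).prod := by
  induction N with
  | zero => simp
  | succ N ih =>
    simp only [List.prod_range_succ]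
    rw [prod_range_map_mul fun i j => (commute_prod_range fun k _ => hf _ _ _ _).symm, ih,
      Nat.mul_succ, prod_range_add]
    congr 2
    refine List.map_congr_left fun i hi => ?_
    rw [List.mem_range] at hi
    rw [Nat.mul_add_mod, Nat.mod_eq_of_lt hi, Nat.mul_add_div (by omega), Nat.div_eq_of_lt hi,
      Nat.add_zero]

variable {R : Type*} [CommMonoid R] [MulAction R M] [IsScalarTower R M M] [SMulCommClass R M M]

theorem mul_prod_range_of_smul {a : M} {f : ℕ → M} {c : ℕ → R} {n : ℕ}
    (h : ∀ i < n, a * f i = c i • (f i * a)) :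
    a * ((List.range n).map f).prod =
      (∏ i ∈ Finset.range n, c i) • (((List.range n).map f).prod * a) := by
  induction n with
  | zero => simp
  | succ n ih =>
    rw [List.prod_range_succ, ← mul_assoc, ih fun i hi => h i (by omega), smul_mul_assoc, mul_assoc,
      h n (by omega), mul_smul_comm, smul_smul, Finset.prod_range_succ, mul_assoc]

theorem prod_range_mul_of_smul {a : M} {f : ℕ → M} {c : ℕ → R} {n : ℕ}
    (h : ∀ i < n, f i * a = c i • (a * f i)) :
    ((List.range n).map f).prod * a =
      (∏ i ∈ Finset.range n, c i) • (a * ((List.range n).map f).prod) := by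
  induction n with
  | zero => simp
  | succ n ih =>
    rw [List.prod_range_succ, mul_assoc, h n (by omega), mul_smul_comm, ← mul_assoc,
      ih fun i hi => h i (by omega), smul_mul_assoc, smul_smul, Finset.prod_range_succ, mul_assoc,
      mul_comm (c n)]

theorem prod_range_mul_prod_range_of_smul {f g : ℕ → M} {c : ℕ → ℕ → R}
    (h : ∀ i j, f i * g j = c i j • (g j * f i)) (m n : ℕ) :
    ((List.range m).map f).prod * ((List.range n).map g).prod =
      (∏ i ∈ Finset.range m, ∏ j ∈ Finset.range n, c i j) •
        (((List.range n).map g).prod * ((List.range m).map f).prod) :=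
  prod_range_mul_of_smul fun i _ => mul_prod_range_of_smul fun j _ => h i j

/-- Normal ordering of an alternating product. -/
theorem prod_range_mul_of_normalOrder {p q : ℕ → M} {c : ℕ → ℕ → R}
    (h : ∀ i j, q i * p j = c i j • (p j * q i)) (n : ℕ) :
    ((List.range n).map fun i => p i * q i).prod =
      (∏ j ∈ Finset.range n, ∏ i ∈ Finset.range j, c i j) •
        (((List.range n).map p).prod * ((List.range n).map q).prod) := by
  induction n with
  | zero => simp
  | succ n ih =>
    simp only [List.prod_range_succ, ih, Finset.prod_range_succ _ n]
    have := prod_range_mul_of_smul (a := p n) (f := q) (n := n) fun i _ => h i n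
    rw [smul_mul_assoc, mul_assoc, ← mul_assoc _ (p n), this, smul_mul_assoc, mul_smul_comm,
      smul_smul]
    simp only [mul_assoc]

end products

section transfer

variable {σ ι : Type*}

/-- A rational power series and a power series with extended nonnegative coefficients
correspond if they come from the same power series with natural number coefficients. -/
def SameNat (F : MvPowerSeries σ ℚ) (G : ESer σ) : Prop :=
  ∃ g : MvPowerSeries σ ℕ, MvPowerSeries.map (Nat.castRingHom ℚ) g = F ∧
    MvPowerSeries.map (Nat.castRingHom ℝ≥0∞) g = G

namespace SameNat

theorem zero : SameNat (0 : MvPowerSeries σ ℚ) 0 := ⟨0, map_zero _, map_zero _⟩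

theorem one : SameNat (1 : MvPowerSeries σ ℚ) 1 := ⟨1, map_one _, map_one _⟩

theorem X (s : σ) : SameNat (MvPowerSeries.X s) (MvPowerSeries.X s) :=
  ⟨MvPowerSeries.X s, MvPowerSeries.map_X _ _, MvPowerSeries.map_X _ _⟩

theorem add {F F' : MvPowerSeries σ ℚ} {G G' : ESer σ} (h : SameNat F G) (h' : SameNat F' G') :
    SameNat (F + F') (G + G') := by
  obtain ⟨g, rfl, rfl⟩ := h
  obtain ⟨g', rfl, rfl⟩ := h'
  exact ⟨g + g', map_add _ _ _, map_add _ _ _⟩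

theorem mul {F F' : MvPowerSeries σ ℚ} {G G' : ESer σ} (h : SameNat F G) (h' : SameNat F' G') :
    SameNat (F * F') (G * G') := by
  obtain ⟨g, rfl, rfl⟩ := h
  obtain ⟨g', rfl, rfl⟩ := h'
  exact ⟨g * g', map_mul _ _ _, map_mul _ _ _⟩

theorem pow {F : MvPowerSeries σ ℚ} {G : ESer σ} (h : SameNat F G) (k : ℕ) :
    SameNat (F ^ k) (G ^ k) := by
  obtain ⟨g, rfl, rfl⟩ := h
  exact ⟨g ^ k, map_pow _ _ _, map_pow _ _ _⟩

theorem prod {F : ι → MvPowerSeries σ ℚ} {G : ι → ESer σ} (s : Finset ι)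
    (h : ∀ i ∈ s, SameNat (F i) (G i)) : SameNat (∏ i ∈ s, F i) (∏ i ∈ s, G i) := by
  classical
  induction s using Finset.induction_on with
  | empty => simpa using one
  | insert a s ha ih =>
    rw [Finset.prod_insert ha, Finset.prod_insert ha]
    exact (h a (by simp)).mul (ih fun i hi => h i (by simp [hi]))

theorem unique {F F' : MvPowerSeries σ ℚ} {G : ESer σ} (h : SameNat F G) (h' : SameNat F' G) :
    F = F' := by
  obtain ⟨g, rfl, rfl⟩ := h
  obtain ⟨g', rfl, hg⟩ := h'
  congr 1
  ext m
  have := congrArg (MvPowerSeries.coeff m) hg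
  simp only [MvPowerSeries.coeff_map, Nat.coe_castRingHom, Nat.cast_inj] at this
  exact this.symm

theorem coeff_ne_top {F : MvPowerSeries σ ℚ} {G : ESer σ} (h : SameNat F G) (m : σ →₀ ℕ) :
    MvPowerSeries.coeff m G ≠ ⊤ := by
  obtain ⟨g, rfl, rfl⟩ := h
  simp [MvPowerSeries.coeff_map]

end SameNat

theorem hasSum_of_hasSum_coeff {f : ι → MvPowerSeries σ ℚ} {g : MvPowerSeries σ ℚ}
    (h : ∀ m, HasSum (fun i => MvPowerSeries.coeff m (f i)) (MvPowerSeries.coeff m g)) :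
    HasSum f g := by
  rw [HasSum]
  refine tendsto_pi_nhds.2 fun m => (h m).congr fun s => ?_
  exact (map_sum (MvPowerSeries.coeff m) f s).symm

instance : T2Space (MvPowerSeries σ ℚ) := inferInstanceAs (T2Space ((σ →₀ ℕ) → ℚ))

theorem SameNat.tsum {F : ι → MvPowerSeries σ ℚ} {G : ι → ESer σ}
    (h : ∀ i, SameNat (F i) (G i)) (hG : ∀ m, MvPowerSeries.coeff m (psum G) ≠ ⊤) :
    SameNat (∑' i, F i) (psum G) := by
  choose g hF hG' using h
  have hfin : ∀ m, (Function.support fun i => MvPowerSeries.coeff m (g i)).Finite := by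
    intro m
    refine (ENNReal.finite_const_le_of_tsum_ne_top (hG m) one_ne_zero).subset fun i hi => ?_
    simp only [← hG', MvPowerSeries.coeff_map, Set.mem_ofPred_eq, Nat.coe_castRingHom]
    exact_mod_cast Nat.one_le_iff_ne_zero.2 hi
  have key : ∀ m, HasSum (fun i => MvPowerSeries.coeff m (g i))
      (∑ i ∈ (hfin m).toFinset, MvPowerSeries.coeff m (g i)) := fun m =>
    hasSum_sum_of_ne_finset_zero fun i hi => by simpa using hi
  refine ⟨fun m => ∑ i ∈ (hfin m).toFinset, MvPowerSeries.coeff m (g i), ?_, ?_⟩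
  · refine (HasSum.tsum_eq (hasSum_of_hasSum_coeff fun m => ?_)).symm
    simp only [← hF, MvPowerSeries.coeff_map]
    exact (key m).map (Nat.castRingHom ℚ) continuous_of_discreteTopology
  · ext m
    simp only [coeff_psum, ← hG', MvPowerSeries.coeff_map]
    exact ((key m).map (Nat.castRingHom ℝ≥0∞) continuous_of_discreteTopology).tsum_eq.symm

theorem coeff_psum_ne_top {f : ι → ESer σ} (hf : ∀ i m, MvPowerSeries.coeff m (f i) ≠ ⊤)
    {S : Set ι} (hS : S.Finite) (h : ∀ i, f i ≠ 0 → i ∈ S) (m : σ →₀ ℕ) :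
    MvPowerSeries.coeff m (psum f) ≠ ⊤ := by
  rw [coeff_psum, tsum_eq_sum (s := hS.toFinset)]
  · exact ENNReal.sum_ne_top.2 fun i _ => hf i m
  · intro i hi
    by_contra h'
    refine hi ((hS.mem_toFinset).2 (h i fun h0 => h' ?_))
    rw [h0, map_zero]

theorem coeff_mul_ne_top {f g : ESer σ} (hf : ∀ m, MvPowerSeries.coeff m f ≠ ⊤)
    (hg : ∀ m, MvPowerSeries.coeff m g ≠ ⊤) (m : σ →₀ ℕ) :
    MvPowerSeries.coeff m (f * g) ≠ ⊤ := by
  classical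
  rw [MvPowerSeries.coeff_mul]
  exact ENNReal.sum_ne_top.2 fun p _ => ENNReal.mul_ne_top (hf _) (hg _)

theorem SameNat.inv_one_sub_X_mul_X {a b : σ} (hab : a ≠ b) :
    SameNat (1 - MvPowerSeries.X a * MvPowerSeries.X b : MvPowerSeries σ ℚ)⁻¹
      (geom (MvPowerSeries.X a * MvPowerSeries.X b)) := by
  classical
  set z : MvPowerSeries σ ℚ := MvPowerSeries.X a * MvPowerSeries.X b with hz
  have h0 : SameNat z (MvPowerSeries.X a * MvPowerSeries.X b) := (SameNat.X a).mul (.X b)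
  have h1 : SameNat (∑' k : ℕ, z ^ k) (geom (MvPowerSeries.X a * MvPowerSeries.X b)) := by
    refine SameNat.tsum (fun k => h0.pow k) fun m => ?_
    rw [coeff_psum, tsum_eq_sum (s := {m a})]
    · exact ENNReal.sum_ne_top.2 fun k _ => (h0.pow k).coeff_ne_top m
    · intro k hk
      rw [mul_pow, MvPowerSeries.X_pow_eq, MvPowerSeries.X_pow_eq,
        MvPowerSeries.monomial_mul_monomial, MvPowerSeries.coeff_monomial, if_neg]
      rintro rfl
      simp [hab] at hk
  have h2 : ∑' k : ℕ, z ^ k = 1 + z * ∑' k : ℕ, z ^ k := by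
    refine h1.unique ?_
    rw [geom_eq]
    exact SameNat.one.add (h0.mul h1)
  have h3 : (1 - z)⁻¹ = ∑' k : ℕ, z ^ k := by
    rw [eq_comm, MvPowerSeries.eq_inv_iff_mul_eq_one (by simp [hz])]
    linear_combination h2
  rwa [h3]

/-- An infinite product is determined by the finite products obtained after setting to zero all
but a part of the variables. -/
theorem SameNat.tprod {F : ι → MvPowerSeries σ ℚ} {G : ι → ESer σ}
    (h : ∀ i, SameNat (F i) (G i)) (T : ℕ → Set σ)
    (hT : ∀ m : σ →₀ ℕ, ∃ N, (m.support : Set σ) ⊆ T N) (I : ℕ → Finset ι)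
    (hI : ∀ N, ∀ i, i ∉ I N → trunc ℝ≥0∞ (T N) (G i) = 1) :
    ∃ P : ESer σ, SameNat (∏' i, F i) P ∧
      ∀ N, trunc ℝ≥0∞ (T N) P = ∏ i ∈ I N, trunc ℝ≥0∞ (T N) (G i) := by
  classical
  choose g hF hG using h
  choose N hN using hT
  have hg : ∀ n, ∀ i, i ∉ I n → trunc ℕ (T n) (g i) = 1 := fun n i hi => by
    have := hI n i hi
    rw [← hG, trunc_map] at this
    ext m
    have := congrArg (MvPowerSeries.coeff m) this
    simp only [MvPowerSeries.coeff_map, MvPowerSeries.coeff_one, Nat.coe_castRingHom] at this ⊢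
    split_ifs at this ⊢ <;> exact_mod_cast this
  have key : ∀ n, ∀ m : σ →₀ ℕ, (m.support : Set σ) ⊆ T n → ∀ s, I n ⊆ s →
      MvPowerSeries.coeff m (∏ i ∈ s, g i) = MvPowerSeries.coeff m (∏ i ∈ I n, g i) := by
    intro n m hm s hs
    rw [← coeff_trunc hm, ← coeff_trunc hm (∏ i ∈ I n, g i), map_prod (trunc ℕ (T n)) g s,
      map_prod (trunc ℕ (T n)) g (I n), Finset.prod_subset hs fun i _ hi => hg n i hi]
  obtain ⟨p, hp⟩ : ∃ p : MvPowerSeries σ ℕ, ∀ m,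
      MvPowerSeries.coeff m p = MvPowerSeries.coeff m (∏ i ∈ I (N m), g i) :=
    ⟨fun m => MvPowerSeries.coeff m (∏ i ∈ I (N m), g i), fun _ => rfl⟩
  have hp' : ∀ n, ∀ m : σ →₀ ℕ, (m.support : Set σ) ⊆ T n →
      MvPowerSeries.coeff m p = MvPowerSeries.coeff m (∏ i ∈ I n, g i) := by
    intro n m hm
    rw [hp, ← key n m hm (I n ∪ I (N m)) Finset.subset_union_left,
      ← key (N m) m (hN m) (I n ∪ I (N m)) Finset.subset_union_right]
  refine ⟨MvPowerSeries.map (Nat.castRingHom ℝ≥0∞) p, ⟨p, ?_, rfl⟩, fun n => ?_⟩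
  · refine (HasProd.tprod_eq ?_).symm
    rw [HasProd]
    refine tendsto_pi_nhds.2 fun m => ?_
    rw [SummationFilter.unconditional_filter]
    refine tendsto_const_nhds.congr' ?_
    filter_upwards [Filter.eventually_ge_atTop (I (N m))] with s hs
    have : MvPowerSeries.coeff m (MvPowerSeries.map (Nat.castRingHom ℚ) p) =
        MvPowerSeries.coeff m (∏ b ∈ s, F b) := by
      simp only [← hF]
      rw [← map_prod, MvPowerSeries.coeff_map, MvPowerSeries.coeff_map, hp,
        key (N m) m (hN m) s hs]
    exact this
  · simp only [← hG, trunc_map]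
    rw [← map_prod, ← map_prod]
    congr 1
    ext m
    by_cases hm : (m.support : Set σ) ⊆ T n
    · rw [coeff_trunc hm, coeff_trunc hm, hp' n m hm]
    · rw [coeff_trunc_of_not hm, coeff_trunc_of_not hm]

theorem ext_trunc {R : Type*} [CommSemiring R] {T : ℕ → Set σ}
    (hT : ∀ m : σ →₀ ℕ, ∃ N, (m.support : Set σ) ⊆ T N) {f g : MvPowerSeries σ R}
    (h : ∀ N, trunc R (T N) f = trunc R (T N) g) : f = g := by
  ext m
  obtain ⟨N, hN⟩ := hT m
  rw [← coeff_trunc hN, h, coeff_trunc hN]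

/-- The entries have finite coefficients, and vanish unless `μ ⊆ λ`. -/
def PMat.FiniteTriangular (A : PMat σ) : Prop := ∀ mu lam,
  (∀ m, MvPowerSeries.coeff m (A mu lam) ≠ ⊤) ∧ (A mu lam ≠ 0 → ∀ i, mu.part i ≤ lam.part i)

namespace PMat.FiniteTriangular

theorem one : FiniteTriangular (1 : PMat σ) := by
  classical
  refine fun mu lam => ⟨fun m => ?_, fun h i => ?_⟩
  · rw [one_apply]
    split_ifs
    · exact SameNat.one.coeff_ne_top m
    · exact SameNat.zero.coeff_ne_top m
  · rw [one_apply] at h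
    rw [show mu = lam by by_contra h'; simp [h'] at h]

theorem mul {A B : PMat σ} (hA : A.FiniteTriangular) (hB : B.FiniteTriangular) :
    (A * B).FiniteTriangular := by
  refine fun mu lam => ⟨coeff_psum_ne_top (fun kap => coeff_mul_ne_top (hA _ _).1 (hB _ _).1)
    lam.finite_setOf_part_le fun kap h => (hB kap lam).2 (right_ne_zero_of_mul h), fun h => ?_⟩
  obtain ⟨kap, hk⟩ : ∃ kap, A mu kap * B kap lam ≠ 0 := by
    by_contra! h'
    exact h ((congrArg psum (funext h')).trans psum_zero)
  exact fun i => ((hA _ _).2 (left_ne_zero_of_mul hk) i).trans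
    ((hB _ _).2 (right_ne_zero_of_mul hk) i)

theorem addStrip {F : MvPowerSeries σ ℚ} {x : ESer σ} (hx : SameNat F x) :
    (addStrip x).FiniteTriangular := by
  classical
  refine fun mu lam => ⟨fun m => ?_, fun h i => ?_⟩
  · rw [_root_.addStrip]
    split_ifs
    · exact (hx.pow _).coeff_ne_top m
    · exact SameNat.zero.coeff_ne_top m
  · by_contra h'
    exact h (if_neg fun hs => h' (hs i).1)

theorem prod_range {A : ℕ → PMat σ} (hA : ∀ n, (A n).FiniteTriangular) (N : ℕ) :
    ((List.range N).map A).prod.FiniteTriangular := by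
  induction N with
  | zero => exact one
  | succ N ih =>
    rw [List.prod_range_succ]
    exact ih.mul (hA N)

/-- The matrix of skew Schur functions in an alphabet only finitely many of whose elements survive
after setting to zero the variables outside each `T N`. -/
theorem schurMat {F : ℕ → MvPowerSeries σ ℚ} {x : ℕ → ESer σ} (hx : ∀ n, SameNat (F n) (x n))
    {T : ℕ → Set σ} (hT : ∀ m : σ →₀ ℕ, ∃ N, (m.support : Set σ) ⊆ T N)
    (hxT : ∀ N, ∃ K, ∀ n, K ≤ n → trunc ℝ≥0∞ (T N) (x n) = 0) :
    (schurMat x).FiniteTriangular := by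
  have key : ∀ N, (truncHom (T N) (_root_.schurMat x)).FiniteTriangular := fun N => by
    obtain ⟨K, hK⟩ := hxT N
    rw [truncHom_schurMat, schurMat_eq_prod hK]
    refine prod_range (fun n => ?_) K
    obtain ⟨g, -, hg⟩ := hx n
    rw [← hg, trunc_map]
    exact addStrip ⟨_, rfl, rfl⟩
  refine fun mu lam => ⟨fun m => ?_, fun h => ?_⟩
  · obtain ⟨N, hN⟩ := hT m
    rw [← coeff_trunc hN]
    exact (key N mu lam).1 m
  · obtain ⟨N, hN⟩ : ∃ N, truncHom (T N) (_root_.schurMat x) mu lam ≠ 0 := by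
      by_contra! h'
      exact h (ext_trunc hT fun N => (h' N).trans (map_zero _).symm)
    exact (key N mu lam).2 hN

end PMat.FiniteTriangular

theorem SameNat.eChainWeight {F : ℕ → MvPowerSeries σ ℚ} {x : ℕ → ESer σ}
    (hx : ∀ n, SameNat (F n) (x n)) {mu lam : Ptn} {c : ℕ → Ptn} (hc : IsSchurChain mu lam c) :
    SameNat (chainWeight F c) (eChainWeight x c) := by
  obtain ⟨N, hN⟩ := hc.exists_eChainWeight_eq
  rw [show chainWeight F c = _root_.eChainWeight F c from rfl, hN, hN]
  exact SameNat.prod _ fun i _ => (hx i).pow _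

theorem SameNat.skewSchur {F : ℕ → MvPowerSeries σ ℚ} {x : ℕ → ESer σ}
    (hx : ∀ n, SameNat (F n) (x n)) (h : (schurMat x).FiniteTriangular) (lam mu : Ptn) :
    SameNat (skewSchur F lam mu) (schurMat x mu lam) :=
  SameNat.tsum (fun c => SameNat.eChainWeight hx c.2) (h mu lam).1

end transfer

section alphabets

open PMat

/-- The variable number `n` of the alphabet `i`, over the extended nonnegative reals. -/
noncomputable def eVar (b : Bool) (i n : ℕ) : ESer (Bool × ℕ × ℕ) := MvPowerSeries.X (b, i, n)

/-- The union of the first `h` of a sequence of alphabets. -/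
noncomputable def eUnion (h : ℕ) (b : Bool) (n : ℕ) : ESer (Bool × ℕ × ℕ) :=
  if h = 0 then 0 else eVar b (n % h) (n / h)

/-- The first `N` variables of all alphabets. -/
def firstVars (N : ℕ) : Set (Bool × ℕ × ℕ) := {s | s.2.2 < N}

theorem exists_support_subset_firstVars (m : Bool × ℕ × ℕ →₀ ℕ) :
    ∃ N, (m.support : Set (Bool × ℕ × ℕ)) ⊆ firstVars N := by
  refine ⟨m.support.sup (fun s => s.2.2) + 1, fun s hs => Nat.lt_succ_of_le ?_⟩
  exact Finset.le_sup (f := fun s : Bool × ℕ × ℕ => s.2.2) hs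

theorem trunc_eVar_of_lt {N n : ℕ} (h : n < N) (b : Bool) (i : ℕ) :
    trunc ℝ≥0∞ (firstVars N) (eVar b i n) = eVar b i n := trunc_X_of_mem h

theorem trunc_eVar_of_le {N n : ℕ} (h : N ≤ n) (b : Bool) (i : ℕ) :
    trunc ℝ≥0∞ (firstVars N) (eVar b i n) = 0 := trunc_X_of_notMem (Nat.not_lt.2 h)

theorem trunc_eUnion_of_le {h N n : ℕ} (hn : h * N ≤ n) (b : Bool) :
    trunc ℝ≥0∞ (firstVars N) (eUnion h b n) = 0 := by
  rw [eUnion]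
  split_ifs with h0
  · exact map_zero _
  · refine trunc_eVar_of_le ?_ b _
    rwa [Nat.le_div_iff_mul_le (Nat.pos_of_ne_zero h0), mul_comm]

theorem truncHom_schurMat_eVar (b : Bool) (i N : ℕ) :
    truncHom (firstVars N) (schurMat (eVar b i)) =
      ((List.range N).map fun n => addStrip (eVar b i n)).prod := by
  rw [truncHom_schurMat, schurMat_eq_prod fun n hn => trunc_eVar_of_le hn b i]
  refine congrArg List.prod (List.map_congr_left fun n hn => ?_)
  rw [trunc_eVar_of_lt (List.mem_range.1 hn)]

theorem truncHom_schurMat_eUnion (h : ℕ) (b : Bool) (N : ℕ) :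
    truncHom (firstVars N) (schurMat (eUnion h b)) =
      ((List.range h).map fun i => truncHom (firstVars N) (schurMat (eVar b i))).prod := by
  simp only [truncHom_schurMat_eVar]
  rw [prod_range_prod_range (f := fun i n => addStrip (eVar b i n))
      fun i j k l => commute_addStrip _ _,
    truncHom_schurMat, schurMat_eq_prod fun n hn => trunc_eUnion_of_le hn b]
  refine congrArg List.prod (List.map_congr_left fun n hn => ?_)
  rw [List.mem_range] at hn
  have h0 : h ≠ 0 := by rintro rfl; simp at hn
  rw [eUnion, if_neg h0, trunc_eVar_of_lt (Nat.div_lt_of_lt_mul hn)]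

theorem commute_truncHom_schurMat_eVar (b : Bool) (i j N : ℕ) :
    Commute (truncHom (firstVars N) (schurMat (eVar b i)))
      (truncHom (firstVars N) (schurMat (eVar b j))) := by
  simp only [truncHom_schurMat_eVar]
  exact commute_prod_range fun _ _ => (commute_prod_range fun _ _ => commute_addStrip _ _).symm

theorem transpose_prod_range {σ : Type*} {f : ℕ → PMat σ} (hf : ∀ i j, Commute (f i) (f j))
    (n : ℕ) : ((List.range n).map f).prod.transpose =
      ((List.range n).map fun i => (f i).transpose).prod := by
  induction n with
  | zero => simp [transpose_one]
  | succ n ih =>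
    rw [List.prod_range_succ, List.prod_range_succ, ← ih, ← transpose_mul,
      (commute_prod_range fun i _ => hf n i).eq]

theorem truncHom_transpose {σ : Type*} (T : Set σ) (A : PMat σ) :
    truncHom T A.transpose = (truncHom T A).transpose := rfl

/-- The factor `Ψ(Yᵃ, Xᵇ)` together with its truncations. -/
theorem exists_sameNat_psi (a b : ℕ) : ∃ P : ESer (Bool × ℕ × ℕ), SameNat (Psi (Ya a) (Xa b)) P ∧
    ∀ N, trunc ℝ≥0∞ (firstVars N) P = ∏ k ∈ Finset.range N, ∏ l ∈ Finset.range N,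
      geom (eVar true a k * eVar false b l) := by
  obtain ⟨P, hP, hN⟩ := SameNat.tprod (F := fun p : ℕ × ℕ => (1 - Ya a p.1 * Xa b p.2)⁻¹)
    (G := fun p => geom (eVar true a p.1 * eVar false b p.2))
    (fun p => SameNat.inv_one_sub_X_mul_X (by simp)) firstVars exists_support_subset_firstVars
    (fun N => Finset.range N ×ˢ Finset.range N) fun N p hp => by
      have h0 : trunc ℝ≥0∞ (firstVars N) (eVar true a p.1 * eVar false b p.2) = 0 := by
        rw [Finset.mem_product, Finset.mem_range, Finset.mem_range, not_and_or, not_lt,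
          not_lt] at hp
        rw [map_mul]
        rcases hp with hp | hp
        · rw [trunc_eVar_of_le hp, zero_mul]
        · rw [trunc_eVar_of_le hp, mul_zero]
      rw [trunc_geom, h0, geom_eq, zero_mul, add_zero]
  refine ⟨P, hP, fun N => ?_⟩
  rw [hN, Finset.prod_product]
  refine Finset.prod_congr rfl fun k hk => Finset.prod_congr rfl fun l hl => ?_
  rw [trunc_geom, map_mul, trunc_eVar_of_lt (Finset.mem_range.1 hk),
    trunc_eVar_of_lt (Finset.mem_range.1 hl)]

/-- The open summation formula, as an identity of matrices of power series in which all sums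
converge. -/
theorem prod_range_schurMat_mul_schurMat {Ψ : ℕ → ℕ → ESer (Bool × ℕ × ℕ)}
    (hΨ : ∀ a b N, trunc ℝ≥0∞ (firstVars N) (Ψ a b) = ∏ k ∈ Finset.range N,
      ∏ l ∈ Finset.range N, geom (eVar true a k * eVar false b l)) (h : ℕ) :
    ((List.range h).map fun i =>
        (schurMat (eVar false i)).transpose * schurMat (eVar true i)).prod =
      (∏ j ∈ Finset.range h, ∏ i ∈ Finset.range j, Ψ i j) •
        ((schurMat (eUnion h false)).transpose * schurMat (eUnion h true)) := by
  refine ext' fun mu lam => ext_trunc exists_support_subset_firstVars fun N => ?_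
  rw [smul_apply, map_mul, ← truncHom_apply, ← truncHom_apply, map_list_prod, List.map_map,
    map_mul, truncHom_transpose, truncHom_schurMat_eUnion, truncHom_schurMat_eUnion,
    transpose_prod_range fun i j => commute_truncHom_schurMat_eVar false i j N]
  have key : ∀ i j, truncHom (firstVars N) (schurMat (eVar true i)) *
      (truncHom (firstVars N) (schurMat (eVar false j))).transpose =
      trunc ℝ≥0∞ (firstVars N) (Ψ i j) •
        ((truncHom (firstVars N) (schurMat (eVar false j))).transpose *
          truncHom (firstVars N) (schurMat (eVar true i))) := by
    intro i j
    rw [truncHom_schurMat_eVar, truncHom_schurMat_eVar,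
      transpose_prod_range fun _ _ => commute_addStrip _ _, hΨ]
    exact prod_range_mul_prod_range_of_smul (fun k l => addStrip_mul_transpose _ _) N N
  have := prod_range_mul_of_normalOrder key h
  simp only [map_prod]
  rw [← smul_apply, ← this]
  refine congrArg (fun l : List (PMat _) => l.prod mu lam) (List.map_congr_left fun i _ => ?_)
  exact map_mul _ _ _

theorem prod_filter_lt_eq_prod_range {R : Type*} [CommMonoid R] (h : ℕ) (f : ℕ → ℕ → R) :
    ∏ q ∈ Finset.univ.filter (fun q : Fin h × Fin h => q.1 < q.2), f q.1 q.2 =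
      ∏ j ∈ Finset.range h, ∏ i ∈ Finset.range j, f i j := by
  rw [Finset.prod_filter, Fintype.prod_prod_type_right, Finset.prod_range]
  refine Finset.prod_congr rfl fun j _ => ?_
  simp only [Fin.lt_def]
  rw [Fin.prod_univ_eq_prod_range (fun i => if i < (j : ℕ) then f i j else 1),
    ← Finset.prod_filter]
  refine Finset.prod_congr (Finset.ext fun i => ?_) fun _ _ => rfl
  have := j.2
  simp only [Finset.mem_filter, Finset.mem_range]
  omega

theorem sameNat_Xa (i n : ℕ) : SameNat (Xa i n) (eVar false i n) := SameNat.X _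

theorem sameNat_Ya (i n : ℕ) : SameNat (Ya i n) (eVar true i n) := SameNat.X _

theorem sameNat_unionA {A : ℕ → ℕ → R0} {b : Bool} (hA : ∀ i n, SameNat (A i n) (eVar b i n))
    (h n : ℕ) : SameNat (unionA h A n) (eUnion h b n) := by
  rw [unionA, eUnion]
  split_ifs
  · exact SameNat.zero
  · exact hA _ _

theorem sameNat_skewSchur {A : ℕ → ℕ → R0} {b : Bool} (hA : ∀ i n, SameNat (A i n) (eVar b i n))
    (i : ℕ) (lam mu : Ptn) : SameNat (skewSchur (A i) lam mu) (schurMat (eVar b i) mu lam) :=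
  SameNat.skewSchur (hA i) (FiniteTriangular.schurMat (hA i) exists_support_subset_firstVars
    fun N => ⟨N, fun _ hn => trunc_eVar_of_le hn b i⟩) lam mu

theorem finiteTriangular_schurMat_eUnion {A : ℕ → ℕ → R0} {b : Bool}
    (hA : ∀ i n, SameNat (A i n) (eVar b i n)) (h : ℕ) :
    (schurMat (eUnion h b)).FiniteTriangular :=
  FiniteTriangular.schurMat (sameNat_unionA hA h) exists_support_subset_firstVars
    fun N => ⟨h * N, fun _ hn => trunc_eUnion_of_le hn b⟩

end alphabets

/-- **Open summation formula** for skew Schur functions (Theorem 2.2,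
equation (2.4)): for any `2h` alphabets `X^0, …, X^{h-1}`, `Y^0, …, Y^{h-1}` and
any fixed partitions `λ^0`, `λ^h`,
`Σ_{λ^1,…,λ^{h-1}} Σ_{μ^0,…,μ^{h-1}} ∏_i s_{λ^i/μ^i}(X^i) s_{λ^{i+1}/μ^i}(Y^i)
  = ∏_{0≤i<j≤h-1} Ψ(Y^i, X^j) · Σ_γ s_{λ^0/γ}(X) s_{λ^h/γ}(Y)`. -/
theorem open_summation_formula (h : ℕ) (lam0 lamh : Ptn) :
    ∑' p : {L : Fin (h + 1) → Ptn // L 0 = lam0 ∧ L (Fin.last h) = lamh} × (Fin h → Ptn),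
      ∏ i : Fin h,
        skewSchur (Xa i) (p.1.1 i.castSucc) (p.2 i) * skewSchur (Ya i) (p.1.1 i.succ) (p.2 i)
    = (∏ q ∈ Finset.univ.filter (fun q : Fin h × Fin h => q.1 < q.2), Psi (Ya q.1) (Xa q.2)) *
        ∑' γ : Ptn, skewSchur (unionA h Xa) lam0 γ * skewSchur (unionA h Ya) lamh γ := by
  choose Ψ hΨ hΨ' using exists_sameNat_psi
  have hX := finiteTriangular_schurMat_eUnion sameNat_Xa h
  have hY := finiteTriangular_schurMat_eUnion sameNat_Ya h
  have right : SameNat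
      ((∏ q ∈ Finset.univ.filter (fun q : Fin h × Fin h => q.1 < q.2), Psi (Ya q.1) (Xa q.2)) *
        ∑' γ : Ptn, skewSchur (unionA h Xa) lam0 γ * skewSchur (unionA h Ya) lamh γ)
      (((List.range h).map fun i =>
        (schurMat (eVar false i)).transpose * schurMat (eVar true i)).prod lam0 lamh) := by
    rw [prod_range_schurMat_mul_schurMat hΨ', PMat.smul_apply,
      prod_filter_lt_eq_prod_range h fun i j => Psi (Ya i) (Xa j)]
    refine (SameNat.prod _ fun j _ => SameNat.prod _ fun i _ => hΨ i j).mul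
      (SameNat.tsum (fun γ => ?_) ?_)
    · exact (SameNat.skewSchur (sameNat_unionA sameNat_Xa h) hX lam0 γ).mul
        (SameNat.skewSchur (sameNat_unionA sameNat_Ya h) hY lamh γ)
    · exact coeff_psum_ne_top (fun γ => coeff_mul_ne_top (hX γ lam0).1 (hY γ lamh).1)
        lam0.finite_setOf_part_le fun γ hγ => (hX γ lam0).2 (left_ne_zero_of_mul hγ)
  have left : ((List.range h).map fun i =>
        (schurMat (eVar false i)).transpose * schurMat (eVar true i)).prod lam0 lamh =
      psum fun p : {L : Fin (h + 1) → Ptn // L 0 = lam0 ∧ L (Fin.last h) = lamh} ×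
          (Fin h → Ptn) => ∏ i : Fin h, schurMat (eVar false i) (p.2 i) (p.1.1 i.castSucc) *
        schurMat (eVar true i) (p.2 i) (p.1.1 i.succ) := by
    rw [PMat.prod_range_apply, psum_prod]
    refine congrArg psum (funext fun L => ?_)
    exact (psum_pi_prod fun (i : Fin h) mu =>
      schurMat (eVar false i) mu (L.1 i.castSucc) * schurMat (eVar true i) mu (L.1 i.succ)).symm
  rw [left] at right
  refine SameNat.unique (SameNat.tsum (fun p => SameNat.prod _ fun i _ => ?_)
    right.coeff_ne_top) right
  exact (sameNat_skewSchur sameNat_Xa i _ _).mul (sameNat_skewSchur sameNat_Ya i _ _)
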